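/- Algebraic core of the Lemma 'Milnor maximal k': Let X be a set and let T be an abstract grope whose leaves are injectively labelled by elements of X (all leaf labels pairwise distinct), with boundary word γ(T) ∈ F_X and class k = class(T). Then the image of γ(T) in the Milnor group M(F_X) does not lie in the (k+1)-st lower central series term M(F_X)^{k+1}. -/

import Mathlib

universe u

open scoped commutatorElement

/-- Relators of the Milnor group: `[g i, h⁻¹ * g i * h]` for all `i` and `h`. -/
def milnorRelators {G : Type*} [Group G] {ι : Type*} (g : ι → G) : Set G :=
  {x | ∃ (i : ι) (h : G), x = ⁅g i, h⁻¹ * g i * h⁆}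

/-- The Milnor group of `G` with respect to the elements `g i`: the quotient of `G`
by the normal closure of the Milnor relators. -/
abbrev MilnorGroup {G : Type*} [Group G] {ι : Type*} (g : ι → G) : Type _ :=
  G ⧸ Subgroup.normalClosure (milnorRelators g)

/-- The quotient map onto the Milnor group. -/
abbrev milnorQuot {G : Type*} [Group G] {ι : Type*} (g : ι → G) : G →* MilnorGroup g :=
  QuotientGroup.mk' _

mutual
/-- An abstract grope with leaves labelled by `X`: either a leaf, or a node carrying a
nonempty finite list of pairs of abstract gropes. -/
inductive AbGrope (X : Type u) : Type u
  | leaf : X → AbGrope X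
  | node : AbGropePairs X → AbGrope X

/-- A nonempty list of pairs of abstract gropes. -/
inductive AbGropePairs (X : Type u) : Type u
  | single : AbGrope X → AbGrope X → AbGropePairs X
  | cons : AbGrope X → AbGrope X → AbGropePairs X → AbGropePairs X
end

mutual
/-- The class of an abstract grope: `1` for a leaf, and for a node the minimum over its
pairs `(A, B)` of `class A + class B`. -/
def gropeClass {X : Type u} : AbGrope X → ℕ
  | .leaf _ => 1
  | .node ps => pairsClass ps

def pairsClass {X : Type u} : AbGropePairs X → ℕ
  | .single a b => gropeClass a + gropeClass b
  | .cons a b t => min (gropeClass a + gropeClass b) (pairsClass t)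
end

mutual
/-- The boundary word of an abstract grope in the free group on its labels:
a leaf gives its label, a node gives the product of commutators of the boundary words
of its pairs. -/
def gropeBoundary {X : Type u} : AbGrope X → FreeGroup X
  | .leaf x => FreeGroup.of x
  | .node ps => pairsBoundary ps

def pairsBoundary {X : Type u} : AbGropePairs X → FreeGroup X
  | .single a b => ⁅gropeBoundary a, gropeBoundary b⁆
  | .cons a b t => ⁅gropeBoundary a, gropeBoundary b⁆ * pairsBoundary t
end

mutual
/-- The list of leaf labels of an abstract grope, from left to right. -/
def gropeLeaves {X : Type u} : AbGrope X → List X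
  | .leaf x => [x]
  | .node ps => pairsLeaves ps

def pairsLeaves {X : Type u} : AbGropePairs X → List X
  | .single a b => gropeLeaves a ++ gropeLeaves b
  | .cons a b t => gropeLeaves a ++ gropeLeaves b ++ pairsLeaves t
end

/-- Elementary matrix with natural number indices. -/
def elemMat (N i j : ℕ) : Matrix (Fin N) (Fin N) ℤ :=
  Matrix.of fun p q => if p.val = i ∧ q.val = j then 1 else 0

theorem elemMat_mul (N i j k : ℕ) (hj : j < N) :
    elemMat N i j * elemMat N j k = elemMat N i k := by
  ext p q
  rw [Matrix.mul_apply, Finset.sum_eq_single (⟨j, hj⟩ : Fin N)]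
  · by_cases h : p.val = i <;> simp [elemMat, h]
  · intro b _ hb
    have : b.val ≠ j := fun h => hb (Fin.ext h)
    simp [elemMat, this]
  · simp

theorem elemMat_mul_zero (N i j k l : ℕ) (hjk : j ≠ k) :
    elemMat N i j * elemMat N k l = 0 := by
  ext p q
  rw [Matrix.mul_apply]
  apply Finset.sum_eq_zero
  intro b _
  by_cases h : b.val = j
  · have : b.val ≠ k := by omega
    simp [elemMat, this]
  · simp [elemMat, h]

/-- Matrices supported on entries `(p, q)` with `p + m ≤ q`. -/
def Band {N : ℕ} (m : ℕ) (M : Matrix (Fin N) (Fin N) ℤ) : Prop :=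
  ∀ p q : Fin N, q.val < p.val + m → M p q = 0

theorem Band.mono {N m n : ℕ} {M : Matrix (Fin N) (Fin N) ℤ} (h : Band m M) (hn : n ≤ m) :
    Band n M := fun p q hpq => h p q (by omega)

theorem Band.mul {N m n : ℕ} {A B : Matrix (Fin N) (Fin N) ℤ} (hA : Band m A) (hB : Band n B) :
    Band (m + n) (A * B) := by
  intro p q hpq
  rw [Matrix.mul_apply]
  apply Finset.sum_eq_zero
  intro b _
  by_cases h : b.val < p.val + m
  · rw [hA p b h, zero_mul]
  · rw [hB b q (by omega), mul_zero]

theorem Band.add {N m : ℕ} {A B : Matrix (Fin N) (Fin N) ℤ} (hA : Band m A) (hB : Band m B) :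
    Band m (A + B) := by
  intro p q hpq
  rw [Matrix.add_apply, hA p q hpq, hB p q hpq, add_zero]

theorem Band.neg {N m : ℕ} {A : Matrix (Fin N) (Fin N) ℤ} (hA : Band m A) :
    Band m (-A) := by
  intro p q hpq
  rw [Matrix.neg_apply, hA p q hpq, neg_zero]

theorem Band.one {N : ℕ} : Band 0 (1 : Matrix (Fin N) (Fin N) ℤ) := by
  intro p q hpq
  exact Matrix.one_apply_ne (by rintro rfl; omega)

theorem Band.elemMat {N i j m : ℕ} (h : i + m ≤ j) : Band m (elemMat N i j) := by
  intro p q hpq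
  have : ¬ (p.val = i ∧ q.val = j) := by omega
  simp [_root_.elemMat, this]

theorem elem_mul_elem {N i j : ℕ} (hij : i < j) {M : Matrix (Fin N) (Fin N) ℤ} (hM : Band 0 M) :
    elemMat N i j * M * elemMat N i j = 0 := by
  ext p q
  rw [Matrix.mul_apply]
  apply Finset.sum_eq_zero
  intro b _
  by_cases hb : b.val = i
  · have : (elemMat N i j * M) p b = 0 := by
      rw [Matrix.mul_apply]
      apply Finset.sum_eq_zero
      intro c _
      by_cases hc : c.val = j
      · rw [hM c b (by omega), mul_zero]
      · simp [elemMat, hc]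
    rw [this, zero_mul]
  · simp [elemMat, hb]

/-- The unitriangular groups filtration. -/
def unip (N m : ℕ) : Subgroup (Matrix (Fin N) (Fin N) ℤ)ˣ where
  carrier := {g | Band m (g.val - 1) ∧ Band m (g.inv - 1)}
  one_mem' := by
    constructor <;> intro p q _ <;> simp [Units.inv_eq_val_inv]
  mul_mem' := by
    rintro a b ⟨ha, ha'⟩ ⟨hb, hb'⟩
    constructor
    · have : (a * b).val - 1 = (a.val - 1) * (b.val - 1) + ((a.val - 1) + (b.val - 1)) := by
        rw [Units.val_mul]; noncomm_ring
      rw [this]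
      exact ((ha.mul hb).mono (by omega)).add (ha.add hb)
    · have : (a * b).inv - 1 = (b.inv - 1) * (a.inv - 1) + ((b.inv - 1) + (a.inv - 1)) := by
        have : (a * b).inv = b.inv * a.inv := rfl
        rw [this]; noncomm_ring
      rw [this]
      exact ((hb'.mul ha').mono (by omega)).add (hb'.add ha')
  inv_mem' := by
    rintro a ⟨ha, ha'⟩
    exact ⟨ha', ha⟩

theorem unip_band0 {N m : ℕ} {g : (Matrix (Fin N) (Fin N) ℤ)ˣ} (hg : g ∈ unip N m) :
    Band 0 g.val := by
  have := (hg.1.mono (Nat.zero_le m)).add Band.one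
  simpa using this

theorem comm_band {N m n : ℕ} {g h : (Matrix (Fin N) (Fin N) ℤ)ˣ} (hg : g ∈ unip N m)
    (hh : h ∈ unip N n) : Band (m + n) (⁅g, h⁆.val - 1) := by
  have key : ⁅g, h⁆.val - 1 =
      ((g.val - 1) * (h.val - 1) + -((h.val - 1) * (g.val - 1))) * (g⁻¹ * h⁻¹).val := by
    have e1 : (g.val - 1) * (h.val - 1) + -((h.val - 1) * (g.val - 1)) =
        (g * h).val - (h * g).val := by
      rw [Units.val_mul, Units.val_mul]; noncomm_ring
    rw [e1, sub_mul, ← Units.val_mul, ← Units.val_mul, ← Units.val_one]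
    congr 2
    · simp [commutatorElement_def, mul_assoc]
    · simp [mul_assoc]
  rw [key]
  have h1 : Band (m + n) ((g.val - 1) * (h.val - 1) + -((h.val - 1) * (g.val - 1))) :=
    (hg.1.mul hh.1).add ((hh.1.mul hg.1).mono (by omega)).neg
  have h2 : Band 0 (g⁻¹ * h⁻¹).val := by
    rw [Units.val_mul]
    exact (unip_band0 (inv_mem hg)).mul (unip_band0 (inv_mem hh))
  exact h1.mul h2

theorem comm_mem_unip {N m n : ℕ} {g h : (Matrix (Fin N) (Fin N) ℤ)ˣ} (hg : g ∈ unip N m)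
    (hh : h ∈ unip N n) : ⁅g, h⁆ ∈ unip N (m + n) := by
  refine ⟨comm_band hg hh, ?_⟩
  have := comm_band hh hg
  rw [← commutatorElement_inv] at this
  rw [add_comm]
  exact this

/-- Transvections. -/
def tv (N i j : ℕ) : (Matrix (Fin N) (Fin N) ℤ)ˣ :=
  if h : i < j then
    { val := 1 + elemMat N i j
      inv := 1 - elemMat N i j
      val_inv := by
        have := elemMat_mul_zero N i j i j (by omega)
        noncomm_ring; simp [this]
      inv_val := by
        have := elemMat_mul_zero N i j i j (by omega)
        noncomm_ring; simp [this] }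
  else 1

theorem tv_val {N i j : ℕ} (h : i < j) : (tv N i j).val = 1 + elemMat N i j := by
  simp [tv, h]

theorem tv_inv {N i j : ℕ} (h : i < j) : (tv N i j).inv = 1 - elemMat N i j := by
  simp only [tv, h, dif_pos]

theorem tv_mem {N i j : ℕ} (h : i < j) : tv N i j ∈ unip N 1 := by
  constructor
  · rw [tv_val h]
    simpa using Band.elemMat (N := N) (m := 1) (i := i) (j := j) (by omega)
  · rw [tv_inv h]
    simpa using (Band.elemMat (N := N) (m := 1) (i := i) (j := j) (by omega)).neg

theorem tv_comm {N a b c : ℕ} (hab : a < b) (hbc : b < c) (hc : b < N) :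
    ⁅tv N a b, tv N b c⁆ = tv N a c := by
  have h : tv N a b * tv N b c = tv N a c * (tv N b c * tv N a b) := by
    apply Units.ext
    simp only [Units.val_mul, tv_val hab, tv_val hbc, tv_val (hab.trans hbc)]
    have h1 := elemMat_mul N a b c hc
    have h2 := elemMat_mul_zero N b c a b (by omega)
    have h3 := elemMat_mul_zero N a c b c (by omega)
    have h4 := elemMat_mul_zero N a c a b (by omega)
    simp only [mul_add, add_mul, mul_one, one_mul, h1, h2, h3, h4, mul_zero, add_zero]
    abel
  rw [commutatorElement_def, h]
  group

theorem tv_milnor {N i j : ℕ} (hij : i < j) {h : (Matrix (Fin N) (Fin N) ℤ)ˣ}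
    (hh : h ∈ unip N 1) : ⁅tv N i j, h⁻¹ * tv N i j * h⁆ = 1 := by
  rw [commutatorElement_eq_one_iff_mul_comm]
  apply Units.ext
  have e1 := elem_mul_elem hij (unip_band0 hh)
  have e2 := elem_mul_elem hij (unip_band0 (inv_mem hh))
  have e3 : (h⁻¹).val * h.val = 1 := by simp
  simp only [Units.val_mul, tv_val hij]
  have e4 : (h⁻¹).val * (1 + elemMat N i j) * h.val
      = 1 + (h⁻¹).val * elemMat N i j * h.val := by
    rw [mul_add, add_mul, mul_one, e3]
  rw [e4]
  have e5 : elemMat N i j * ((h⁻¹).val * elemMat N i j * h.val) = 0 := by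
    rw [← mul_assoc, ← mul_assoc, e2, zero_mul]
  have e6 : ((h⁻¹).val * elemMat N i j * h.val) * elemMat N i j = 0 := by
    rw [mul_assoc, mul_assoc, ← mul_assoc (elemMat N i j), e1, mul_zero]
  simp only [mul_add, add_mul, mul_one, one_mul, e5, e6, add_zero]
  abel

/-- The elements allowed as images of generators. -/
def Good {N : ℕ} (g : (Matrix (Fin N) (Fin N) ℤ)ˣ) : Prop :=
  g = 1 ∨ ∃ i j, i < j ∧ g = tv N i j

theorem lift_mem_of_mem_lcs {X : Type u} {N : ℕ} (f : X → (Matrix (Fin N) (Fin N) ℤ)ˣ)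
    (hf : ∀ x, Good (f x)) (n : ℕ) (w : FreeGroup X)
    (hw : milnorQuot (FreeGroup.of : X → FreeGroup X) w ∈
      Subgroup.lowerCentralSeries
        (⊤ : Subgroup (MilnorGroup (FreeGroup.of : X → FreeGroup X))) n) :
    True ∧ FreeGroup.lift f w ∈ unip N (n + 1) := by
  refine ⟨trivial, ?_⟩
  have hfm : ∀ x, f x ∈ unip N 1 := by
    intro x
    rcases hf x with h | ⟨i, j, hij, h⟩
    · rw [h]; exact one_mem _
    · rw [h]; exact tv_mem hij
  have hr : ∀ v, FreeGroup.lift f v ∈ unip N 1 := by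
    intro v
    induction v using FreeGroup.induction_on with
    | C1 => rw [map_one]; exact one_mem _
    | of x => rw [FreeGroup.lift_apply_of]; exact hfm x
    | inv_of x h => rw [map_inv]; exact inv_mem h
    | mul x y hx hy => rw [map_mul]; exact mul_mem hx hy
  have hker : Subgroup.normalClosure (milnorRelators (FreeGroup.of : X → FreeGroup X)) ≤
      (FreeGroup.lift f).ker := by
    apply Subgroup.normalClosure_le_normal
    rintro _ ⟨x, h, rfl⟩
    rw [SetLike.mem_coe, MonoidHom.mem_ker, map_commutatorElement, map_mul, map_mul, map_inv,
      FreeGroup.lift_apply_of]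
    rcases hf x with e | ⟨i, j, hij, e⟩
    · rw [e]; simp
    · rw [e]; exact tv_milnor hij (hr h)
  let ρ : MilnorGroup (FreeGroup.of : X → FreeGroup X) →* (Matrix (Fin N) (Fin N) ℤ)ˣ :=
    QuotientGroup.lift _ (FreeGroup.lift f) hker
  have hρ : ∀ v, ρ (milnorQuot (FreeGroup.of : X → FreeGroup X) v) = FreeGroup.lift f v :=
    fun v => rfl
  have hρ1 : ∀ z, ρ z ∈ unip N 1 := by
    intro z
    obtain ⟨v, rfl⟩ := QuotientGroup.mk'_surjective _ z
    exact hr v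
  have hl : ∀ n, Subgroup.lowerCentralSeries
      (⊤ : Subgroup (MilnorGroup (FreeGroup.of : X → FreeGroup X))) n ≤
        (unip N (n + 1)).comap ρ := by
    intro n
    induction n with
    | zero => intro z _; exact hρ1 z
    | succ n ih =>
      rw [Subgroup.lowerCentralSeries_succ]
      first
      | rw [Subgroup.commutator_le]
        intro a ha b _
        rw [Subgroup.mem_comap, map_commutatorElement]
        exact comm_mem_unip (ih ha) (hρ1 b)
  exact hl n hw

mutual
theorem gropeClass_pos {X : Type u} : ∀ T : AbGrope X, 0 < gropeClass T
  | .leaf _ => by simp [gropeClass]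
  | .node ps => by rw [gropeClass]; exact pairsClass_pos ps

theorem pairsClass_pos {X : Type u} : ∀ ps : AbGropePairs X, 0 < pairsClass ps
  | .single a b => by
    rw [pairsClass]; have := gropeClass_pos a; omega
  | .cons a b t => by
    rw [pairsClass]
    have := gropeClass_pos a
    have := pairsClass_pos t
    omega
end

mutual
theorem lift_congr {X : Type u} {G : Type*} [Group G] (f g : X → G) :
    ∀ T : AbGrope X, (∀ x ∈ gropeLeaves T, f x = g x) →
      FreeGroup.lift f (gropeBoundary T) = FreeGroup.lift g (gropeBoundary T)
  | .leaf x, h => by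
    simpa [gropeBoundary] using h x (by simp [gropeLeaves])
  | .node ps, h => by
    rw [gropeBoundary]
    exact lift_congr_pairs f g ps (fun x hx => h x (by rwa [gropeLeaves]))

theorem lift_congr_pairs {X : Type u} {G : Type*} [Group G] (f g : X → G) :
    ∀ T : AbGropePairs X, (∀ x ∈ pairsLeaves T, f x = g x) →
      FreeGroup.lift f (pairsBoundary T) = FreeGroup.lift g (pairsBoundary T)
  | .single a b, h => by
    rw [pairsBoundary, map_commutatorElement, map_commutatorElement,
      lift_congr f g a (fun x hx => h x (by simp [pairsLeaves, hx])),
      lift_congr f g b (fun x hx => h x (by simp [pairsLeaves, hx]))]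
  | .cons a b t, h => by
    rw [pairsBoundary, map_mul, map_mul, map_commutatorElement, map_commutatorElement,
      lift_congr f g a (fun x hx => h x (by simp [pairsLeaves, hx])),
      lift_congr f g b (fun x hx => h x (by simp [pairsLeaves, hx])),
      lift_congr_pairs f g t (fun x hx => h x (by simp [pairsLeaves, hx]))]
end

theorem lift_one_fun {X : Type u} {G : Type*} [Group G] (w : FreeGroup X) :
    FreeGroup.lift (fun _ : X => (1 : G)) w = 1 := by
  have : FreeGroup.lift (fun _ : X => (1 : G)) = 1 := by
    ext x; simp
  rw [this]; rfl

/-- Combining two representations with disjoint supports on a commutator. -/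
theorem combine {X : Type u} (N : ℕ) (A B : AbGrope X) (a : ℕ)
    (hdis : ∀ x ∈ gropeLeaves A, x ∉ gropeLeaves B)
    (hb : a + (gropeClass A + gropeClass B) < N)
    (hA : ∃ f : X → (Matrix (Fin N) (Fin N) ℤ)ˣ,
      (∀ x, Good (f x) ∧ (x ∉ gropeLeaves A → f x = 1)) ∧
      FreeGroup.lift f (gropeBoundary A) = tv N a (a + gropeClass A))
    (hB : ∃ f : X → (Matrix (Fin N) (Fin N) ℤ)ˣ,
      (∀ x, Good (f x) ∧ (x ∉ gropeLeaves B → f x = 1)) ∧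
      FreeGroup.lift f (gropeBoundary B) =
        tv N (a + gropeClass A) (a + gropeClass A + gropeClass B)) :
    ∃ f : X → (Matrix (Fin N) (Fin N) ℤ)ˣ,
      (∀ x, Good (f x) ∧ (x ∉ gropeLeaves A ++ gropeLeaves B → f x = 1)) ∧
      FreeGroup.lift f ⁅gropeBoundary A, gropeBoundary B⁆ =
        tv N a (a + (gropeClass A + gropeClass B)) := by
  classical
  obtain ⟨f, hf, hfA⟩ := hA
  obtain ⟨g, hg, hgB⟩ := hB
  refine ⟨fun x => if x ∈ gropeLeaves A then f x else g x, ?_, ?_⟩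
  · intro x
    by_cases hx : x ∈ gropeLeaves A
    · simpa [hx] using (hf x).1
    · simpa [hx] using hg x
  · have := gropeClass_pos A
    have := gropeClass_pos B
    rw [map_commutatorElement, lift_congr _ f A, lift_congr _ g B, hfA, hgB,
      tv_comm (by omega) (by omega) (by omega), add_assoc]
    · intro x hx
      have : x ∉ gropeLeaves A := fun h => hdis x h hx
      simp [this]
    · intro x hx
      simp [hx]

mutual
theorem exists_rep {X : Type u} (N : ℕ) :
    ∀ (T : AbGrope X), (gropeLeaves T).Nodup → ∀ a, a + gropeClass T < N →
    ∃ f : X → (Matrix (Fin N) (Fin N) ℤ)ˣ,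
      (∀ x, Good (f x) ∧ (x ∉ gropeLeaves T → f x = 1)) ∧
      FreeGroup.lift f (gropeBoundary T) = tv N a (a + gropeClass T)
  | .leaf x, _, a, _ => by
    classical
    refine ⟨fun y => if y = x then tv N a (a + 1) else 1, ?_, ?_⟩
    · intro y
      by_cases hy : y = x
      · simp only [hy, if_true]
        exact ⟨Or.inr ⟨a, a + 1, by omega, rfl⟩, by simp [gropeLeaves]⟩
      · simp [hy, Good]
    · simp [gropeBoundary, gropeClass]
  | .node ps, hn, a, ha => by
    rw [gropeBoundary, gropeClass, gropeLeaves]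
    rw [gropeLeaves] at hn
    rw [gropeClass] at ha
    exact exists_rep_pairs N ps hn a ha

theorem exists_rep_pairs {X : Type u} (N : ℕ) :
    ∀ (T : AbGropePairs X), (pairsLeaves T).Nodup → ∀ a, a + pairsClass T < N →
    ∃ f : X → (Matrix (Fin N) (Fin N) ℤ)ˣ,
      (∀ x, Good (f x) ∧ (x ∉ pairsLeaves T → f x = 1)) ∧
      FreeGroup.lift f (pairsBoundary T) = tv N a (a + pairsClass T)
  | .single A B, hn, a, ha => by
    rw [pairsLeaves] at hn
    rw [pairsClass] at ha
    rw [pairsLeaves, pairsBoundary, pairsClass]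
    obtain ⟨h1, h2, h3⟩ := List.nodup_append'.1 hn
    exact combine N A B a (fun x hx hx' => h3 hx hx') ha
      (exists_rep N A h1 a (by omega)) (exists_rep N B h2 _ (by omega))
  | .cons A B t, hn, a, ha => by
    rw [pairsLeaves] at hn
    rw [pairsClass] at ha
    rw [pairsLeaves, pairsBoundary, pairsClass]
    obtain ⟨h12, ht, hd⟩ := List.nodup_append'.1 hn
    obtain ⟨h1, h2, h3⟩ := List.nodup_append'.1 h12
    rcases le_total (gropeClass A + gropeClass B) (pairsClass t) with hle | hle
    · rw [min_eq_left hle] at ha ⊢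
      obtain ⟨f, hf, hfe⟩ := combine N A B a (fun x hx hx' => h3 hx hx') ha
        (exists_rep N A h1 a (by omega)) (exists_rep N B h2 _ (by omega))
      refine ⟨f, fun x => ⟨(hf x).1, fun hx => (hf x).2 fun h => hx (by
        rw [List.mem_append]; exact Or.inl h)⟩, ?_⟩
      rw [map_mul, hfe, lift_congr_pairs f (fun _ => 1) t, lift_one_fun, mul_one]
      intro x hx
      exact (hf x).2 fun h => hd h hx
    · rw [min_eq_right hle] at ha ⊢
      obtain ⟨f, hf, hfe⟩ := exists_rep_pairs N t ht a ha
      refine ⟨f, fun x => ⟨(hf x).1, fun hx => (hf x).2 fun h => hx (by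
        rw [List.mem_append]; exact Or.inr h)⟩, ?_⟩
      rw [map_mul, hfe, map_commutatorElement, lift_congr f (fun _ => 1) A, lift_one_fun,
        commutatorElement_one_left, one_mul]
      intro x hx
      exact (hf x).2 fun h => hd (by rw [List.mem_append]; exact Or.inl hx) h
end

/-- Algebraic core of "Milnor maximal k": if the leaves of an abstract grope `T` of class
`k` are injectively labelled by elements of `X` (pairwise distinct labels), then the image
of its boundary word `γ(T)` in the Milnor group `M(F_X)` does not lie in the `(k+1)`-st
lower central series term `M(F_X)^{k+1} = lowerCentralSeries (M(F_X)) (gropeClass T)`. -/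
theorem gropeBoundary_not_in_lcs_milnor {X : Type u} (T : AbGrope X)
    (hinj : (gropeLeaves T).Nodup) :
    milnorQuot (FreeGroup.of : X → FreeGroup X) (gropeBoundary T) ∉
      Subgroup.lowerCentralSeries (⊤ : Subgroup (MilnorGroup (FreeGroup.of : X → FreeGroup X)))
        (gropeClass T) := by
  obtain ⟨f, hf, hT⟩ := exists_rep (gropeClass T + 1) T hinj 0 (by omega)
  intro hmem
  obtain ⟨_, hb⟩ := lift_mem_of_mem_lcs f (fun x => (hf x).1) _ _ hmem
  have hk := gropeClass_pos T
  have h0 := hT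
  rw [h0] at hb
  have h1 := hb.1 ⟨0, by omega⟩ ⟨gropeClass T, by omega⟩ (by simp)
  simp [tv, elemMat, hk] at h1
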